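/- arXiv:1312.5280 — 6 statements merged into one kernel-verified Lean document; each statement's English description precedes it below -/
import Mathlib

section
/- Let T_1 be the tree on 12 vertices obtained from a path b_1 b_2 … b_8 by attaching one pendant leaf to each of b_2, b_3, b_6, b_7. Then T_1 admits no (1,2,2)-packing coloring. -/
/-- `c` is an `s`-packing coloring of the simple graph `G`: for each color `i`, any two
distinct vertices with color `i` are at graph distance strictly greater than `s i`
(vertices in different connected components trivially satisfy this). -/
def IsPackingColoring {V : Type*} (G : SimpleGraph V) {k : ℕ} (s : Fin k → ℕ)
    (c : V → Fin k) : Prop :=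
  ∀ u v : V, u ≠ v → c u = c v → G.Reachable u v → s (c u) < G.dist u v

/-- The tree `T₁`: a path `b₁ b₂ … b₈` (vertices `0,…,7`) with one pendant leaf
attached to each of `b₂, b₃, b₆, b₇` (leaves `8, 9, 10, 11`). -/
def treeT1 : SimpleGraph (Fin 12) :=
  SimpleGraph.fromRel (fun u v =>
    (u, v) ∈ ([(0,1),(1,2),(2,3),(3,4),(4,5),(5,6),(6,7),
               (1,8),(2,9),(5,10),(6,11)] : List (Fin 12 × Fin 12)))

namespace IsPackingColoring

variable {V : Type*} {G : SimpleGraph V} {c : V → Fin 3}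

theorem ne_of_adj (hc : IsPackingColoring G ![1, 2, 2] c) {u v : V} (h : G.Adj u v) :
    c u ≠ c v := by
  intro he
  have hd := hc u v h.ne he h.reachable
  rw [SimpleGraph.dist_eq_one_iff_adj.mpr h] at hd
  generalize c u = i at hd
  fin_cases i <;> simp at hd

theorem eq_zero_of_common_neighbor (hc : IsPackingColoring G ![1, 2, 2] c) {u m v : V}
    (hum : G.Adj u m) (hmv : G.Adj m v) (huv : u ≠ v) (he : c u = c v) : c u = 0 := by
  have hd := hc u v huv he (hum.reachable.trans hmv.reachable)
  have hle : G.dist u v ≤ 2 := SimpleGraph.dist_le (.cons hum (.cons hmv .nil))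
  generalize c u = i at hd
  fin_cases i <;> simp at hd ⊢ <;> omega

/-- A vertex with three distinct neighbors cannot receive the first color. -/
theorem ne_zero_of_three_neighbors (hc : IsPackingColoring G ![1, 2, 2] c) {m x y z : V}
    (hx : G.Adj m x) (hy : G.Adj m y) (hz : G.Adj m z)
    (hxy : x ≠ y) (hxz : x ≠ z) (hyz : y ≠ z) : c m ≠ 0 := by
  have hmx := hc.ne_of_adj hx
  have hmy := hc.ne_of_adj hy
  have hmz := hc.ne_of_adj hz
  have := hc.eq_zero_of_common_neighbor hx.symm hy hxy
  have := hc.eq_zero_of_common_neighbor hx.symm hz hxz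
  have := hc.eq_zero_of_common_neighbor hy.symm hz hyz
  omega

/-- If `u` and `v` are adjacent and avoid the first color, then any other neighbor of `v`
receives the first color. -/
theorem eq_zero_of_adj_of_ne_zero (hc : IsPackingColoring G ![1, 2, 2] c) {u v w : V}
    (huv : G.Adj u v) (hvw : G.Adj v w) (huw : u ≠ w) (hu : c u ≠ 0) (hv : c v ≠ 0) :
    c w = 0 := by
  have := hc.ne_of_adj huv
  have := hc.ne_of_adj hvw
  have := hc.eq_zero_of_common_neighbor huv hvw huw
  omega

end IsPackingColoring

instance : DecidableRel treeT1.Adj :=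
  inferInstanceAs (DecidableRel (SimpleGraph.fromRel _).Adj)

/-- `T₁` admits no `(1,2,2)`-packing coloring. -/
theorem treeT1_not_122_colorable :
    ¬ ∃ c : Fin 12 → Fin 3, IsPackingColoring treeT1 ![1, 2, 2] c := by
  rintro ⟨c, hc⟩
  have h₁ : c 1 ≠ 0 := hc.ne_zero_of_three_neighbors (x := 0) (y := 2) (z := 8)
    (by decide) (by decide) (by decide) (by decide) (by decide) (by decide)
  have h₂ : c 2 ≠ 0 := hc.ne_zero_of_three_neighbors (x := 1) (y := 3) (z := 9)
    (by decide) (by decide) (by decide) (by decide) (by decide) (by decide)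
  have h₅ : c 5 ≠ 0 := hc.ne_zero_of_three_neighbors (x := 4) (y := 6) (z := 10)
    (by decide) (by decide) (by decide) (by decide) (by decide) (by decide)
  have h₆ : c 6 ≠ 0 := hc.ne_zero_of_three_neighbors (x := 5) (y := 7) (z := 11)
    (by decide) (by decide) (by decide) (by decide) (by decide) (by decide)
  have h₃ : c 3 = 0 :=
    hc.eq_zero_of_adj_of_ne_zero (u := 1) (by decide) (by decide) (by decide) h₁ h₂
  have h₄ : c 4 = 0 :=
    hc.eq_zero_of_adj_of_ne_zero (u := 6) (by decide) (by decide) (by decide) h₆ h₅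
  exact hc.ne_of_adj (u := 3) (v := 4) (by decide) (h₃.trans h₄.symm)
end

section
/- A tree T admits a (1,2,2)-packing coloring if and only if T contains no subgraph isomorphic to a tree from the family 𝒯. -/
/-- The tree `T₀`: a path `a₁ a₂ a₃ a₄ a₅` (vertices `0,…,4`) with one pendant leaf
attached to each of `a₂, a₃, a₄` (leaves `5, 6, 7`). -/
def treeT0 : SimpleGraph (Fin 8) :=
  SimpleGraph.fromRel (fun u v =>
    (u, v) ∈ ([(0,1),(1,2),(2,3),(3,4),(1,5),(2,6),(3,7)] : List (Fin 8 × Fin 8)))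

/-- The tree obtained from `T` by removing the edge `uv`, adding four new vertices
`u₁ = n, u₂ = n+1, u₃ = n+2, w = n+3` and adding the edges
`u u₁`, `u₁ u₂`, `u₂ u₃`, `u₃ v` and `u₂ w`. -/
def extendTree {n : ℕ} (T : SimpleGraph (Fin n)) (u v : Fin n) :
    SimpleGraph (Fin (n + 4)) :=
  SimpleGraph.fromRel (fun a b =>
    (∃ a' b' : Fin n, a = Fin.castAdd 4 a' ∧ b = Fin.castAdd 4 b' ∧ T.Adj a' b' ∧
      ¬(a' = u ∧ b' = v) ∧ ¬(a' = v ∧ b' = u)) ∨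
    (a = Fin.castAdd 4 u ∧ b = Fin.natAdd n 0) ∨
    (a = Fin.natAdd n 0 ∧ b = Fin.natAdd n 1) ∨
    (a = Fin.natAdd n 1 ∧ b = Fin.natAdd n 2) ∨
    (a = Fin.natAdd n 2 ∧ b = Fin.castAdd 4 v) ∨
    (a = Fin.natAdd n 1 ∧ b = Fin.natAdd n 3))

/-- The family `𝒯` (up to isomorphism, represented on the vertex types `Fin n`):
it contains `T₀` and `T₁`, and is closed under the extension operation applied to a
pair of adjacent vertices that both have degree `2`. -/
inductive InFamilyT : ∀ n : ℕ, SimpleGraph (Fin n) → Prop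
  | base0 : InFamilyT 8 treeT0
  | base1 : InFamilyT 12 treeT1
  | extend {n : ℕ} (T : SimpleGraph (Fin n)) (u v : Fin n) :
      InFamilyT n T → T.Adj u v →
      (T.neighborSet u).ncard = 2 → (T.neighborSet v).ncard = 2 →
      InFamilyT (n + 4) (extendTree T u v)

/-- A vertex of degree at least three, phrased so that a neighbor avoiding two given vertices
can be extracted directly. -/
def IsBranching {V : Type*} (G : SimpleGraph V) (v : V) : Prop :=
  ∀ p q : V, ∃ w, G.Adj v w ∧ w ≠ p ∧ w ≠ q

/-- The sets of vertices that can receive the two colors of distance `2` in a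
`(1,2,2)`-packing coloring of a tree: the complement is independent and consists of vertices
of degree at most two, and every vertex of the set has at most one neighbor in the set. -/
structure IsPackingCore {V : Type*} (G : SimpleGraph V) (J : V → Prop) : Prop where
  cover : ∀ u v, G.Adj u v → J u ∨ J v
  unique : ∀ v x y, J v → J x → J y → G.Adj v x → G.Adj v y → x = y
  branching : ∀ v x y z, G.Adj v x → G.Adj v y → G.Adj v z → x ≠ y → x ≠ z → y ≠ z → J v

/-- `Forces G v c` says that the branch of `G` at `v` through its neighbor `c` forces `c` to lie
in every packing core containing `v`. -/
inductive Forces {V : Type*} (G : SimpleGraph V) : V → V → Prop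
  | adj {v c : V} : G.Adj v c → IsBranching G c → Forces G v c
  | step {v c d e f : V} : G.Adj v c → G.Adj c d → G.Adj d e → d ≠ v → e ≠ c →
      IsBranching G e → Forces G e f → f ≠ d → Forces G v c

lemma IsBranching.of_three {V : Type*} {G : SimpleGraph V} {v x y z : V} (hx : G.Adj v x)
    (hy : G.Adj v y) (hz : G.Adj v z) (hxy : x ≠ y) (hxz : x ≠ z) (hyz : y ≠ z) :
    IsBranching G v := by
  intro p q
  by_cases h₁ : x ≠ p ∧ x ≠ q
  · exact ⟨x, hx, h₁⟩
  by_cases h₂ : y ≠ p ∧ y ≠ q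
  · exact ⟨y, hy, h₂⟩
  refine ⟨z, hz, ?_⟩
  grind

lemma Forces.adj' {V : Type*} {G : SimpleGraph V} {v c : V} (h : Forces G v c) : G.Adj v c := by
  cases h <;> assumption

lemma Forces.exists_isBranching {V : Type*} {G : SimpleGraph V} {v c : V} (h : Forces G v c) :
    ∃ w, IsBranching G w := by
  cases h with
  | adj _ h => exact ⟨_, h⟩
  | step _ _ _ _ _ h => exact ⟨_, h⟩

/-- A parent function on a graph, rooted at `r`, together with a depth function. -/
structure IsRooting {V : Type*} (G : SimpleGraph V) (r : V) (par : V → V) (d : V → ℕ) :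
    Prop where
  depth_root : d r = 0
  adj_par : ∀ v, v ≠ r → G.Adj v (par v)
  depth_par : ∀ v, v ≠ r → d v = d (par v) + 1
  eq_par : ∀ u v, G.Adj u v → (u ≠ r ∧ par u = v) ∨ (v ≠ r ∧ par v = u)

lemma IsRooting.par_par_ne {V : Type*} {G : SimpleGraph V} {r : V} {par : V → V} {d : V → ℕ}
    (h : IsRooting G r par d) {v : V} (hv : v ≠ r) (hp : par v ≠ r) : par (par v) ≠ v := by
  intro e
  have h₁ := h.depth_par v hv
  have h₂ := h.depth_par _ hp
  rw [e] at h₂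
  omega

lemma SimpleGraph.IsTree.exists_isRooting {V : Type*} {G : SimpleGraph V} (hG : G.IsTree)
    (r : V) : ∃ par d, IsRooting G r par d := by
  have hex : ∀ v, ∃ u, v ≠ r → G.Adj v u ∧ G.dist r v = G.dist r u + 1 := by
    intro v
    by_cases hv : v = r
    · exact ⟨v, fun h => absurd hv h⟩
    obtain ⟨p, hp, hl⟩ := hG.connected.exists_path_of_dist r v
    have hnil : ¬ p.Nil := SimpleGraph.Walk.not_nil_of_ne (Ne.symm hv)
    refine ⟨p.penultimate, fun _ => ?_⟩
    have hadj := p.adj_penultimate hnil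
    refine ⟨hadj.symm, ?_⟩
    rcases hG.dist_eq_dist_add_one_of_adj r hadj with h | h
    · have := SimpleGraph.dist_le p.dropLast
      have := SimpleGraph.Walk.length_dropLast_add_one hnil
      omega
    · exact h
  choose par hpar using hex
  have huniq : ∀ v u u', G.Adj v u → G.Adj v u' → G.dist r v = G.dist r u + 1 →
      G.dist r v = G.dist r u' + 1 → u = u' := by
    intro v u u' hu hu' hd hd'
    obtain ⟨p, hp⟩ := hG.connected.exists_walk_length_eq_dist r u
    obtain ⟨p', hp'⟩ := hG.connected.exists_walk_length_eq_dist r u'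
    have h₁ : (p.concat hu.symm).IsPath :=
      SimpleGraph.Walk.isPath_of_length_eq_dist _ (by simp [hp, hd])
    have h₂ : (p'.concat hu'.symm).IsPath :=
      SimpleGraph.Walk.isPath_of_length_eq_dist _ (by simp [hp', hd'])
    have := (hG.existsUnique_path r v).unique h₁ h₂
    simpa using congrArg SimpleGraph.Walk.penultimate this
  refine ⟨par, G.dist r, by simp, fun v hv => (hpar v hv).1, fun v hv => (hpar v hv).2, ?_⟩
  intro u v huv
  rcases hG.dist_eq_dist_add_one_of_adj r huv with h | h
  · have hu : u ≠ r := by rintro rfl; simp at h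
    exact Or.inl ⟨hu, huniq u _ _ (hpar u hu).1 huv (hpar u hu).2 h⟩
  · have hv : v ≠ r := by rintro rfl; simp at h
    exact Or.inr ⟨hv, huniq v _ _ (hpar v hv).1 huv.symm (hpar v hv).2 h⟩

lemma IsRooting.exists_rec {V α : Type*} {G : SimpleGraph V} {r : V} {par : V → V} {d : V → ℕ}
    (h : IsRooting G r par d) (a : α) (Φ : V → α → α) :
    ∃ g : V → α, g r = a ∧ ∀ v, v ≠ r → g v = Φ v (g (par v)) := by
  let k : ℕ → V → α := fun n => Nat.rec (fun _ => a) (fun _ f v => Φ v (f (par v))) n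
  refine ⟨fun v => k (d v) v, ?_, fun v hv => ?_⟩
  · simp only [h.depth_root]; rfl
  · simp only [h.depth_par v hv]; rfl

lemma IsRooting.isPackingCore {V : Type*} {G : SimpleGraph V} {r : V} {par : V → V} {d : V → ℕ}
    (h : IsRooting G r par d) (hr : IsBranching G r ∨ ∀ v, ¬ IsBranching G v)
    (hF : ∀ v x y, IsBranching G v → Forces G v x → Forces G v y → x = y)
    {J : V → Prop} (hJr : J r)
    (hJ : ∀ v, v ≠ r → (J v ↔ IsBranching G v ∨ ¬ J (par v) ∨ Forces G (par v) v)) :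
    IsPackingCore G J := by
  have hbig : ∀ v, IsBranching G v → J v := fun v hv => by
    by_cases hvr : v = r
    · exact hvr ▸ hJr
    · exact (hJ v hvr).2 (Or.inl hv)
  have hroot : ∀ v, IsBranching G v → IsBranching G r := fun v hv =>
    hr.resolve_right fun h => h v hv
  have hsmall : ∀ v x y z, ¬ IsBranching G v → G.Adj v x → G.Adj v y → G.Adj v z →
      x ≠ y → x ≠ z → y = z := fun v x y z hv hx hy hz hxy hxz => by
    by_contra hyz
    exact hv (.of_three hx hy hz hxy hxz hyz)
  have hforce : ∀ v x, J v → J x → x ≠ r → par x = v → Forces G v x := by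
    intro v x hv hx hxr hp
    have hadj := h.adj_par x hxr
    have := (hJ x hxr).1 hx
    rw [hp] at this hadj
    rcases this with h | h | h
    · exact .adj hadj.symm h
    · exact absurd hv h
    · exact h
  have hone : ∀ v x, J v → J x → x ≠ r → par x = v → v ≠ r → J (par v) → False := by
    intro v x hv hx hxr hxv hvr hp
    have hvx := hforce v x hv hx hxr hxv
    have hxp : x ≠ par v := by
      intro e
      exact h.par_par_ne hxr (hxv ▸ hvr) (by rw [hxv, e])
    have hvp := h.adj_par v hvr
    by_cases hvb : IsBranching G v
    · by_cases hpb : IsBranching G (par v)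
      · exact hxp (hF v _ _ hvb hvx (.adj hvp hpb))
      have hpr : par v ≠ r := fun e => hpb (e ▸ hroot v hvb)
      have hpq := h.adj_par _ hpr
      have hqv := h.par_par_ne hvr hpr
      rcases (hJ _ hpr).1 hp with h₁ | h₁ | h₁
      · exact hpb h₁
      · have hqr : par (par v) ≠ r := fun e => h₁ (e ▸ hJr)
        have hqs := h.adj_par _ hqr
        have := mt (hJ _ hqr).2 h₁
        push Not at this
        refine this.2.2 (.step hqs.symm hpq.symm hvp.symm ?_ hqv.symm hvb hvx hxp)
        exact (h.par_par_ne hpr hqr).symm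
      · cases h₁ with
        | adj _ hb => exact hpb hb
        | @step _ _ d e f a₁ a₂ a₃ n₁ n₂ hb hf n₃ =>
          have : d = v := hsmall _ _ _ _ hpb hpq a₂ hvp.symm n₁.symm hqv
          subst this
          exact n₃ (hF e _ _ hb hf (.adj a₃.symm hvb))
    · rcases (hJ _ hvr).1 hv with h₁ | h₁ | h₁
      · exact hvb h₁
      · exact h₁ hp
      · cases h₁ with
        | adj _ hb => exact hvb hb
        | @step _ _ d e f a₁ a₂ a₃ n₁ n₂ hb hf n₃ =>
          have : d = x := hsmall _ _ _ _ hvb hvp a₂ hvx.adj' n₁.symm hxp.symm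
          subst this
          by_cases hdb : IsBranching G d
          · exact n₃ (hF e _ _ hb hf (.adj a₃.symm hdb))
          cases hvx with
          | adj _ hb => exact hdb hb
          | @step _ _ d' e' f' b₁ b₂ b₃ m₁ m₂ hb' hf' m₃ =>
            have : d' = e := hsmall _ _ _ _ hdb b₁.symm b₂ a₃ m₁.symm n₂.symm
            subst this
            exact m₃ (hF e' _ _ hb' hf' (.adj b₃.symm hb))
  refine ⟨?_, ?_, ?_⟩
  · intro u v huv
    rcases h.eq_par u v huv with ⟨hu, e⟩ | ⟨hv, e⟩
    · have := hJ u hu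
      rw [e] at this
      tauto
    · have := hJ v hv
      rw [e] at this
      tauto
  · intro v x y hv hx hy hvx hvy
    by_contra hxy
    rcases h.eq_par v x hvx with ⟨h₁, h₂⟩ | ⟨h₁, h₂⟩ <;>
      rcases h.eq_par v y hvy with ⟨h₃, h₄⟩ | ⟨h₃, h₄⟩
    · exact hxy (h₂.symm.trans h₄)
    · exact hone v y hv hy h₃ h₄ h₁ (h₂ ▸ hx)
    · exact hone v x hv hx h₁ h₂ h₃ (h₄ ▸ hy)
    · have hfx := hforce v x hv hx h₁ h₂
      have hfy := hforce v y hv hy h₃ h₄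
      by_cases hvb : IsBranching G v
      · exact hxy (hF v x y hvb hfx hfy)
      have hvr : v ≠ r := by
        rintro rfl
        obtain ⟨w, hw⟩ := hfx.exists_isBranching
        exact hvb (hroot w hw)
      have hne : ∀ z, z ≠ r → par z = v → par v ≠ z := fun z hz hzv e =>
        h.par_par_ne hz (hzv ▸ hvr) (by rw [hzv, e])
      exact hxy (hsmall v _ _ _ hvb (h.adj_par v hvr) hvx hvy (hne x h₁ h₂) (hne y h₃ h₄))
  · intro v x y z hx hy hz hxy hxz hyz
    exact hbig v (.of_three hx hy hz hxy hxz hyz)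

lemma SimpleGraph.IsTree.exists_isPackingCore {V : Type*} {G : SimpleGraph V} (hG : G.IsTree)
    (hF : ∀ v x y, IsBranching G v → Forces G v x → Forces G v y → x = y) :
    ∃ J r, IsPackingCore G J ∧ J r := by
  obtain ⟨r, hr⟩ : ∃ r, IsBranching G r ∨ ∀ v, ¬ IsBranching G v := by
    by_cases h : ∃ v, IsBranching G v
    · exact h.imp fun v hv => Or.inl hv
    · have := hG.connected.nonempty
      exact ⟨Classical.arbitrary V, Or.inr (not_exists.1 h)⟩
  obtain ⟨par, d, h⟩ := hG.exists_isRooting r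
  obtain ⟨J, hJr, hJ⟩ := h.exists_rec True
    (fun v P => IsBranching G v ∨ ¬ P ∨ Forces G (par v) v)
  have hJr' : J r := hJr ▸ trivial
  exact ⟨J, r, h.isPackingCore hr hF hJr' fun v hv => by rw [hJ v hv], hJr'⟩

lemma SimpleGraph.exists_adj_adj_of_dist_le_two {V : Type*} {G : SimpleGraph V} {u v : V}
    (hr : G.Reachable u v) (huv : u ≠ v) (h : G.dist u v ≤ 2) :
    G.Adj u v ∨ ∃ w, G.Adj w u ∧ G.Adj w v := by
  obtain ⟨p, hp⟩ := hr.exists_walk_length_eq_dist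
  cases p with
  | nil => exact absurd rfl huv
  | cons h₁ p =>
    cases p with
    | nil => exact Or.inl h₁
    | cons h₂ p =>
      cases p with
      | nil => exact Or.inr ⟨_, h₁.symm, h₂⟩
      | cons h₃ p => simp only [SimpleGraph.Walk.length_cons] at hp; omega

lemma SimpleGraph.dist_le_two_of_adj_adj {V : Type*} {G : SimpleGraph V} {u v w : V}
    (hu : G.Adj w u) (hv : G.Adj w v) : G.dist u v ≤ 2 := by
  simpa using SimpleGraph.dist_le (SimpleGraph.Walk.cons hu.symm (.cons hv .nil))

lemma IsPackingCore.exists_isPackingColoring {V : Type*} {G : SimpleGraph V} (hG : G.IsTree)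
    {J : V → Prop} (hJ : IsPackingCore G J) {r : V} (hr : J r) :
    ∃ c : V → Fin 3, IsPackingColoring G ![1, 2, 2] c := by
  classical
  obtain ⟨par, d, h⟩ := hG.exists_isRooting r
  obtain ⟨κ, -, hκ⟩ := h.exists_rec false (fun v b => if J v then !b else b)
  have hadj : ∀ u v, G.Adj u v → J u → J v → κ u ≠ κ v := by
    intro u v huv hu hv
    rcases h.eq_par u v huv with ⟨h₁, h₂⟩ | ⟨h₁, h₂⟩
    · rw [hκ u h₁, h₂]; simp [hu]
    · rw [hκ v h₁, h₂]; simp [hv]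
  have hdist : ∀ u v, u ≠ v → J u → J v → G.Reachable u v → G.dist u v ≤ 2 → κ u ≠ κ v := by
    intro u v huv hu hv hreach hd
    rcases SimpleGraph.exists_adj_adj_of_dist_le_two hreach huv hd with h₁ | ⟨w, hwu, hwv⟩
    · exact hadj u v h₁ hu hv
    have hw : ¬ J w := fun hw => huv (hJ.unique w u v hw hu hv hwu hwv)
    have hwr : w ≠ r := by rintro rfl; exact hw hr
    have hκw := hκ w hwr
    rw [if_neg hw] at hκw
    have key : ∀ u v, G.Adj w v → u ≠ v → J v → par w = u → κ u ≠ κ v := by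
      intro u v hwv huv hv e
      rcases h.eq_par w v hwv with ⟨h₁, h₂⟩ | ⟨h₁, h₂⟩
      · exact absurd (e.symm.trans h₂) huv
      · rw [hκ v h₁, h₂, hκw, e]; simp [hv]
    have hp := h.adj_par w hwr
    by_cases e₁ : par w = u
    · exact key u v hwv huv hv e₁
    by_cases e₂ : par w = v
    · exact (key v u hwu huv.symm hu e₂).symm
    exact absurd (hJ.branching w _ u v hp hwu hwv e₁ e₂ huv) hw
  refine ⟨fun v => if J v then (if κ v then 1 else 2) else 0, ?_⟩
  intro u v huv hc hreach
  by_cases hu : J u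
  · by_cases hv : J v
    · have : κ u = κ v := by
        simp only [if_pos hu, if_pos hv] at hc
        cases h₁ : κ u <;> cases h₂ : κ v <;> simp_all
      have hd : 2 < G.dist u v := by
        by_contra hd
        exact hdist u v huv hu hv hreach (by omega) this
      simp only [if_pos hu]
      cases κ u <;> simpa using hd
    · simp only [if_pos hu, if_neg hv] at hc
      cases h₁ : κ u <;> simp_all
  · have hv : ¬ J v := by
      intro hv
      simp only [if_neg hu, if_pos hv] at hc
      cases h₁ : κ v <;> simp_all
    simp only [if_neg hu]
    exact hreach.one_lt_dist_of_ne_of_not_adj huv fun e => (hJ.cover u v e).elim hu hv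

lemma IsPackingColoring.isPackingCore {V : Type*} {G : SimpleGraph V} {c : V → Fin 3}
    (hc : IsPackingColoring G ![1, 2, 2] c) : IsPackingCore G (fun v => c v ≠ 0) := by
  have hadj : ∀ u v, G.Adj u v → c u ≠ c v := by
    intro u v h e
    have := hc u v h.ne e h.reachable
    rw [SimpleGraph.dist_eq_one_iff_adj.2 h] at this
    generalize c u = i at this
    fin_cases i <;> simp at this
  have hdist : ∀ w u v, G.Adj w u → G.Adj w v → u ≠ v → c u = c v → c u = 0 := by
    intro w u v hu hv huv e
    have h₁ := hc u v huv e (hu.symm.reachable.trans hv.reachable)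
    have h₂ := SimpleGraph.dist_le_two_of_adj_adj hu hv
    generalize c u = i at h₁ ⊢
    fin_cases i <;> simp at h₁ ⊢ <;> omega
  refine ⟨?_, ?_, ?_⟩
  · intro u v h
    have := hadj u v h
    by_contra! h'
    exact this (h'.1.trans h'.2.symm)
  · intro v x y hv hx hy hvx hvy
    by_contra hxy
    have h₁ := hadj v x hvx
    have h₂ := hadj v y hvy
    have h₃ := hdist v x y hvx hvy hxy
    omega
  · intro v x y z hx hy hz hxy hxz hyz hv
    have h₁ := hadj v x hx
    have h₂ := hadj v y hy
    have h₃ := hadj v z hz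
    have h₄ := hdist v x y hx hy hxy
    have h₅ := hdist v x z hx hz hxz
    have h₆ := hdist v y z hy hz hyz
    omega

lemma IsPackingCore.comap {V W : Type*} {G : SimpleGraph V} {T : SimpleGraph W} {J : V → Prop}
    (hJ : IsPackingCore G J) {f : W → V} (hf : Function.Injective f)
    (hadj : ∀ a b, T.Adj a b → G.Adj (f a) (f b)) : IsPackingCore T (fun a => J (f a)) where
  cover _ _ h := hJ.cover _ _ (hadj _ _ h)
  unique _ _ _ hv hx hy h₁ h₂ := hf (hJ.unique _ _ _ hv hx hy (hadj _ _ h₁) (hadj _ _ h₂))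
  branching _ _ _ _ h₁ h₂ h₃ n₁ n₂ n₃ := hJ.branching _ _ _ _ (hadj _ _ h₁) (hadj _ _ h₂)
    (hadj _ _ h₃) (hf.ne n₁) (hf.ne n₂) (hf.ne n₃)

lemma Fin.castAdd_ne_natAdd {n m : ℕ} (a : Fin n) (i : Fin m) :
    Fin.castAdd m a ≠ Fin.natAdd n i := by
  intro e
  have := congrArg Fin.val e
  simp only [Fin.val_castAdd, Fin.val_natAdd] at this
  omega

@[simp]
lemma extendTree_adj_castAdd_castAdd {n : ℕ} (T : SimpleGraph (Fin n)) (u v a b : Fin n) :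
    (extendTree T u v).Adj (Fin.castAdd 4 a) (Fin.castAdd 4 b) ↔
      T.Adj a b ∧ ¬(a = u ∧ b = v) ∧ ¬(a = v ∧ b = u) := by
  have h := @Fin.castAdd_ne_natAdd n 4
  simp only [extendTree, SimpleGraph.fromRel_adj, h, false_and, and_false, or_false,
    (Fin.castAdd_injective n 4).eq_iff]
  constructor
  · rintro ⟨-, ⟨a', b', rfl, rfl, h₁, h₂⟩ | ⟨a', b', rfl, rfl, h₁, h₂⟩⟩
    · exact ⟨h₁, h₂⟩
    · exact ⟨h₁.symm, fun h => h₂.2 h.symm, fun h => h₂.1 h.symm⟩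
  · rintro ⟨h₁, h₂⟩
    exact ⟨(Fin.castAdd_injective n 4).ne h₁.ne, Or.inl ⟨a, b, rfl, rfl, h₁, h₂⟩⟩

@[simp]
lemma extendTree_adj_castAdd_natAdd {n : ℕ} (T : SimpleGraph (Fin n)) (u v a : Fin n)
    (i : Fin 4) : (extendTree T u v).Adj (Fin.castAdd 4 a) (Fin.natAdd n i) ↔
      (a = u ∧ i = 0) ∨ (a = v ∧ i = 2) := by
  have h := @Fin.castAdd_ne_natAdd n 4
  simp only [extendTree, SimpleGraph.fromRel_adj, h, (h _ _).symm, false_and, and_false, or_false,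
    (Fin.castAdd_injective n 4).eq_iff, (Fin.natAdd_injective 4 n).eq_iff, exists_false, false_or,
    ne_eq, not_false_eq_true, true_and]
  tauto

@[simp]
lemma extendTree_adj_natAdd_natAdd {n : ℕ} (T : SimpleGraph (Fin n)) (u v : Fin n)
    (i j : Fin 4) : (extendTree T u v).Adj (Fin.natAdd n i) (Fin.natAdd n j) ↔
      (i = 1 ∧ j ≠ 1) ∨ (j = 1 ∧ i ≠ 1) := by
  have h := @Fin.castAdd_ne_natAdd n 4
  simp only [extendTree, SimpleGraph.fromRel_adj, (h _ _).symm, false_and, and_false,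
    (Fin.natAdd_injective 4 n).eq_iff, exists_false, false_or, ne_eq]
  omega

@[simp]
lemma extendTree_adj_natAdd_castAdd {n : ℕ} (T : SimpleGraph (Fin n)) (u v a : Fin n)
    (i : Fin 4) : (extendTree T u v).Adj (Fin.natAdd n i) (Fin.castAdd 4 a) ↔
      (a = u ∧ i = 0) ∨ (a = v ∧ i = 2) := by
  rw [SimpleGraph.adj_comm, extendTree_adj_castAdd_natAdd]

lemma Set.not_three_of_ncard_eq_two {α : Type*} {s : Set α} (hs : s.ncard = 2) {x y z : α}
    (hx : x ∈ s) (hy : y ∈ s) (hz : z ∈ s) (hxy : x ≠ y) (hxz : x ≠ z) : y = z := by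
  obtain ⟨a, b, -, rfl⟩ := Set.ncard_eq_two.1 hs
  simp only [Set.mem_insert_iff, Set.mem_singleton_iff] at hx hy hz
  grind

lemma IsPackingCore.of_deleteEdges_of_exists {V : Type*} {T : SimpleGraph V} {u v : V}
    (huv : T.Adj u v) (hu : (T.neighborSet u).ncard = 2) {K : V → Prop}
    (hK : IsPackingCore (T.deleteEdges {s(u, v)}) K) (hv : K v)
    (hx : ∃ x, x ≠ v ∧ T.Adj u x ∧ K x) : IsPackingCore T (fun a => K a ∧ a ≠ u) := by
  obtain ⟨x, hxv, hux, hKx⟩ := hx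
  have hnbr : ∀ b, T.Adj u b → K b := by
    intro b hb
    by_cases h : v = b
    · exact h ▸ hv
    · exact Set.not_three_of_ncard_eq_two hu huv hux hb hxv.symm h ▸ hKx
  have hold : ∀ a b, T.Adj a b → a ≠ u → b ≠ u → (T.deleteEdges {s(u, v)}).Adj a b := by
    intro a b h ha hb
    simp [h, ha, hb]
  refine ⟨?_, ?_, ?_⟩
  · intro a b h
    by_cases ha : a = u
    · exact Or.inr ⟨hnbr b (ha ▸ h), fun e => h.ne (ha.trans e.symm)⟩
    by_cases hb : b = u
    · exact Or.inl ⟨hnbr a (hb ▸ h.symm), ha⟩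
    exact (hK.cover a b (hold a b h ha hb)).imp (⟨·, ha⟩) (⟨·, hb⟩)
  · rintro a b c ⟨ha, ha'⟩ ⟨hb, hb'⟩ ⟨hc, hc'⟩ hab hac
    exact hK.unique a b c ha hb hc (hold a b hab ha' hb') (hold a c hac ha' hc')
  · intro a b c d hb hc hd hbc hbd hcd
    have ha : a ≠ u := by
      rintro rfl
      exact hcd (Set.not_three_of_ncard_eq_two hu hb hc hd hbc hbd)
    refine ⟨?_, ha⟩
    by_contra hKa
    by_cases hu' : T.Adj a u
    · exact hKa (hnbr a hu'.symm)
    have hne : ∀ e, T.Adj a e → e ≠ u := fun e he h => hu' (h ▸ he)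
    exact hKa (hK.branching a b c d (hold _ _ hb ha (hne _ hb)) (hold _ _ hc ha (hne _ hc))
      (hold _ _ hd ha (hne _ hd)) hbc hbd hcd)

lemma IsPackingCore.exists_of_deleteEdges {V : Type*} {T : SimpleGraph V} {u v : V}
    (huv : T.Adj u v) (hu : (T.neighborSet u).ncard = 2) (hv : (T.neighborSet v).ncard = 2)
    {K : V → Prop} (hK : IsPackingCore (T.deleteEdges {s(u, v)}) K) (huvK : K u ∨ K v) :
    ∃ J, IsPackingCore T J := by
  by_cases h₁ : K v ∧ ∃ x, x ≠ v ∧ T.Adj u x ∧ K x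
  · exact ⟨_, hK.of_deleteEdges_of_exists huv hu h₁.1 h₁.2⟩
  by_cases h₂ : K u ∧ ∃ x, x ≠ u ∧ T.Adj v x ∧ K x
  · exact ⟨_, IsPackingCore.of_deleteEdges_of_exists huv.symm hv (Sym2.eq_swap ▸ hK) h₂.1 h₂.2⟩
  have hold : ∀ a b, T.Adj a b → ¬ (a = u ∧ b = v) → ¬ (a = v ∧ b = u) →
      (T.deleteEdges {s(u, v)}).Adj a b := by
    intro a b h h₁ h₂
    simp [h]
    tauto
  refine ⟨K, ?_, ?_, ?_⟩
  · intro a b h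
    by_cases ha : a = u ∧ b = v
    · rwa [ha.1, ha.2]
    by_cases hb : a = v ∧ b = u
    · rw [hb.1, hb.2]; exact huvK.symm
    exact hK.cover a b (hold a b h ha hb)
  · intro a b c ha hb hc hab hac
    by_contra hbc
    by_cases h : a = u
    · subst h
      by_cases hbv : b = v
      · exact h₁ ⟨hbv ▸ hb, c, fun e => hbc (hbv.trans e.symm), hac, hc⟩
      by_cases hcv : c = v
      · exact h₁ ⟨hcv ▸ hc, b, hbv, hab, hb⟩
      exact hbc (hK.unique a b c ha hb hc (hold _ _ hab (by tauto) fun e => huv.ne e.1)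
        (hold _ _ hac (by tauto) fun e => huv.ne e.1))
    by_cases h' : a = v
    · subst h'
      by_cases hbu : b = u
      · exact h₂ ⟨hbu ▸ hb, c, fun e => hbc (hbu.trans e.symm), hac, hc⟩
      by_cases hcu : c = u
      · exact h₂ ⟨hcu ▸ hc, b, hbu, hab, hb⟩
      exact hbc (hK.unique a b c ha hb hc (hold _ _ hab (by tauto) (by tauto))
        (hold _ _ hac (by tauto) (by tauto)))
    exact hbc (hK.unique a b c ha hb hc (hold _ _ hab (by tauto) (by tauto))
      (hold _ _ hac (by tauto) (by tauto)))
  · intro a b c d hb hc hd hbc hbd hcd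
    have hau : a ≠ u := by
      rintro rfl
      exact hcd (Set.not_three_of_ncard_eq_two hu hb hc hd hbc hbd)
    have hav : a ≠ v := by
      rintro rfl
      exact hcd (Set.not_three_of_ncard_eq_two hv hb hc hd hbc hbd)
    exact hK.branching a b c d (hold _ _ hb (by tauto) (by tauto))
      (hold _ _ hc (by tauto) (by tauto)) (hold _ _ hd (by tauto) (by tauto)) hbc hbd hcd

lemma IsPackingCore.exists_of_extendTree {n : ℕ} {T : SimpleGraph (Fin n)} {u v : Fin n}
    (huv : T.Adj u v) (hu : (T.neighborSet u).ncard = 2) (hv : (T.neighborSet v).ncard = 2)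
    {J : Fin (n + 4) → Prop} (hJ : IsPackingCore (extendTree T u v) J) :
    ∃ J, IsPackingCore T J := by
  have hinj : Function.Injective (Fin.castAdd 4 : Fin n → Fin (n + 4)) := Fin.castAdd_injective n 4
  have hK := hJ.comap (T := T.deleteEdges {s(u, v)}) hinj (by simp)
  refine hK.exists_of_deleteEdges huv hu hv ?_
  have hne : ∀ i j : Fin 4, i ≠ j → Fin.natAdd n i ≠ Fin.natAdd n j :=
    fun i j => (Fin.natAdd_injective 4 n).ne
  have h₁ : J (Fin.natAdd n 1) := hJ.branching _ (Fin.natAdd n 0) (Fin.natAdd n 2)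
    (Fin.natAdd n 3) (by simp) (by simp) (by simp) (hne _ _ (by decide)) (hne _ _ (by decide))
    (hne _ _ (by decide))
  have h₂ : ¬ (J (Fin.natAdd n 0) ∧ J (Fin.natAdd n 2)) := fun h =>
    hne 0 2 (by decide) (hJ.unique (Fin.natAdd n 1) _ _ h₁ h.1 h.2 (by simp) (by simp))
  have h₃ := hJ.cover (Fin.castAdd 4 u) (Fin.natAdd n 0) (by simp)
  have h₄ := hJ.cover (Fin.natAdd n 2) (Fin.castAdd 4 v) (by simp)
  tauto

lemma InFamilyT.not_isPackingCore {n : ℕ} {T : SimpleGraph (Fin n)} (hT : InFamilyT n T) :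
    ∀ J, ¬ IsPackingCore T J := by
  induction hT with
  | base0 =>
    intro J hJ
    have h₁ : J 1 := hJ.branching 1 0 2 5 (by simp [treeT0]) (by simp [treeT0])
      (by simp [treeT0]) (by decide) (by decide) (by decide)
    have h₂ : J 2 := hJ.branching 2 1 3 6 (by simp [treeT0]) (by simp [treeT0])
      (by simp [treeT0]) (by decide) (by decide) (by decide)
    have h₃ : J 3 := hJ.branching 3 2 4 7 (by simp [treeT0]) (by simp [treeT0])
      (by simp [treeT0]) (by decide) (by decide) (by decide)
    have := hJ.unique 2 1 3 h₂ h₁ h₃ (by simp [treeT0]) (by simp [treeT0])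
    exact absurd this (by decide)
  | base1 =>
    intro J hJ
    have h₁ : J 1 := hJ.branching 1 0 2 8 (by simp [treeT1]) (by simp [treeT1])
      (by simp [treeT1]) (by decide) (by decide) (by decide)
    have h₂ : J 2 := hJ.branching 2 1 3 9 (by simp [treeT1]) (by simp [treeT1])
      (by simp [treeT1]) (by decide) (by decide) (by decide)
    have h₅ : J 5 := hJ.branching 5 4 6 10 (by simp [treeT1]) (by simp [treeT1])
      (by simp [treeT1]) (by decide) (by decide) (by decide)
    have h₆ : J 6 := hJ.branching 6 5 7 11 (by simp [treeT1]) (by simp [treeT1])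
      (by simp [treeT1]) (by decide) (by decide) (by decide)
    rcases hJ.cover 3 4 (by simp [treeT1]) with h | h
    · have := hJ.unique 2 1 3 h₂ h₁ h (by simp [treeT1]) (by simp [treeT1])
      exact absurd this (by decide)
    · have := hJ.unique 5 4 6 h₅ h h₆ (by simp [treeT1]) (by simp [treeT1])
      exact absurd this (by decide)
  | extend T u v _ huv hu hv ih =>
    intro J hJ
    obtain ⟨J', hJ'⟩ := hJ.exists_of_extendTree huv hu hv
    exact ih J' hJ'

lemma InFamilyT.preconnected {n : ℕ} {T : SimpleGraph (Fin n)} (hT : InFamilyT n T) :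
    T.Preconnected := by
  induction hT with
  | base0 =>
    have h : ∀ a b, treeT0.Adj a b → treeT0.Reachable 0 a → treeT0.Reachable 0 b :=
      fun a b hab h => h.trans hab.reachable
    have h₁ := h 0 1 (by simp [treeT0]) .rfl
    have h₂ := h 1 2 (by simp [treeT0]) h₁
    have h₃ := h 2 3 (by simp [treeT0]) h₂
    have h₄ := h 3 4 (by simp [treeT0]) h₃
    have h₅ := h 1 5 (by simp [treeT0]) h₁
    have h₆ := h 2 6 (by simp [treeT0]) h₂
    have h₇ := h 3 7 (by simp [treeT0]) h₃
    have key : ∀ a, treeT0.Reachable 0 a := by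
      intro a
      fin_cases a <;> first | exact .rfl | assumption
    exact fun a b => (key a).symm.trans (key b)
  | base1 =>
    have h : ∀ a b, treeT1.Adj a b → treeT1.Reachable 0 a → treeT1.Reachable 0 b :=
      fun a b hab h => h.trans hab.reachable
    have h₁ := h 0 1 (by simp [treeT1]) .rfl
    have h₂ := h 1 2 (by simp [treeT1]) h₁
    have h₃ := h 2 3 (by simp [treeT1]) h₂
    have h₄ := h 3 4 (by simp [treeT1]) h₃
    have h₅ := h 4 5 (by simp [treeT1]) h₄
    have h₆ := h 5 6 (by simp [treeT1]) h₅
    have h₇ := h 6 7 (by simp [treeT1]) h₆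
    have h₈ := h 1 8 (by simp [treeT1]) h₁
    have h₉ := h 2 9 (by simp [treeT1]) h₂
    have h₁₀ := h 5 10 (by simp [treeT1]) h₅
    have h₁₁ := h 6 11 (by simp [treeT1]) h₆
    have key : ∀ a, treeT1.Reachable 0 a := by
      intro a
      fin_cases a <;> first | exact .rfl | assumption
    exact fun a b => (key a).symm.trans (key b)
  | @extend n T u v _ huv hu hv ih =>
    have h₀ : (extendTree T u v).Reachable (Fin.castAdd 4 u) (Fin.natAdd n 0) :=
      SimpleGraph.Adj.reachable (by simp)
    have h₁ : (extendTree T u v).Reachable (Fin.castAdd 4 u) (Fin.natAdd n 1) :=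
      h₀.trans (SimpleGraph.Adj.reachable (by simp))
    have h₂ : (extendTree T u v).Reachable (Fin.castAdd 4 u) (Fin.natAdd n 2) :=
      h₁.trans (SimpleGraph.Adj.reachable (by simp))
    have h₃ : (extendTree T u v).Reachable (Fin.castAdd 4 u) (Fin.natAdd n 3) :=
      h₁.trans (SimpleGraph.Adj.reachable (by simp))
    have h₄ : (extendTree T u v).Reachable (Fin.castAdd 4 u) (Fin.castAdd 4 v) :=
      h₂.trans (SimpleGraph.Adj.reachable (by simp))
    have hadj : ∀ a b, T.Adj a b →
        (extendTree T u v).Reachable (Fin.castAdd 4 a) (Fin.castAdd 4 b) := by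
      intro a b hab
      by_cases h : a = u ∧ b = v
      · rw [h.1, h.2]; exact h₄
      by_cases h' : a = v ∧ b = u
      · rw [h'.1, h'.2]; exact h₄.symm
      exact SimpleGraph.Adj.reachable (by simp [hab, h, h'])
    have hold : ∀ a b, T.Walk a b →
        (extendTree T u v).Reachable (Fin.castAdd 4 a) (Fin.castAdd 4 b) := by
      intro a b p
      induction p with
      | nil => exact .rfl
      | cons h _ ih => exact (hadj _ _ h).trans ih
    have key : ∀ a, (extendTree T u v).Reachable (Fin.castAdd 4 u) a := by
      intro a
      induction a using Fin.addCases with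
      | left a => exact (ih u a).elim (hold u a)
      | right i => fin_cases i <;> assumption
    exact fun a b => (key a).symm.trans (key b)

lemma SimpleGraph.IsAcyclic.injective_of_locally_injective {V W : Type*} {G : SimpleGraph V}
    {T : SimpleGraph W} (hG : G.IsAcyclic) (hT : T.Preconnected) (f : T →g G)
    (hf : ∀ a b c, T.Adj a b → T.Adj a c → b ≠ c → f b ≠ f c) : Function.Injective f := by
  have hchain : ∀ a b (p : T.Walk a b), p.IsPath → List.IsChain (· ≠ ·) (p.map f).edges := by
    intro a b p hp
    induction p with
    | nil => simp
    | @cons a b c h p ih =>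
      have ih := ih hp.of_cons
      cases p with
      | nil => simp
      | @cons _ d _ h' q =>
        have had : a ≠ d := by
          rintro rfl
          rw [SimpleGraph.Walk.cons_isPath_iff] at hp
          exact hp.2 (by simp)
        have := hf b a d h.symm h' had
        simp only [SimpleGraph.Walk.map_cons, SimpleGraph.Walk.edges_cons,
          List.isChain_cons_cons] at ih ⊢
        refine ⟨?_, ih⟩
        simp only [ne_eq, Sym2.eq_iff, not_or]
        refine ⟨fun e => (f.map_adj h).ne e.1, fun e => this e.1⟩
  intro a b hab
  obtain ⟨p, hp⟩ := (hT a b).exists_isPath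
  have hpath := (hG.isPath_iff_isChain (p.map f)).2 (hchain a b p hp)
  have hlen : ∀ {x y : V} (q : G.Walk x y), q.IsPath → x = y → q.length = 0 := by
    rintro x y q hq rfl
    exact (SimpleGraph.Walk.isPath_iff_nil.1 hq).length_eq_zero
  exact SimpleGraph.Walk.eq_of_length_eq_zero (by simpa using hlen _ hpath hab)

/-- Adjacency in the infinite comb, whose spine is `ℕ × {false}` and in which the vertex
`(i, true)` is a pendant leaf at the spine vertex `(i, false)`. -/
def CombAdj (p q : ℕ × Bool) : Prop :=
  (p.2 = false ∧ q.2 = false ∧ (q.1 = p.1 + 1 ∨ p.1 = q.1 + 1)) ∨ (p.1 = q.1 ∧ p.2 ≠ q.2)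

/-- The vertices of the comb which form the tree of the family with `m + 3` leaves attached
to a path on `3 * m + 5` vertices. -/
def IsCombVertex (m : ℕ) (p : ℕ × Bool) : Prop :=
  p.1 ≤ 3 * m + 4 ∧ (p.2 = true → p.1 = 1 ∨ p.1 = 3 * m + 3 ∨ ∃ j ≤ m, p.1 = 3 * j + 2)

/-- The map opening a gap of three spine vertices between the spine vertices `3` and `4`. -/
def combShift (p : ℕ × Bool) : ℕ × Bool := (if p.1 ≤ 3 then p.1 else p.1 + 3, p.2)

lemma combShift_injective : Function.Injective combShift := by
  rintro ⟨i, b⟩ ⟨j, c⟩ h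
  simp only [combShift, Prod.mk.injEq] at h ⊢
  grind

lemma CombAdj.symm {p q : ℕ × Bool} (h : CombAdj p q) : CombAdj q p := by
  unfold CombAdj at *
  grind

lemma CombAdj.combShift {p q : ℕ × Bool} (h : CombAdj p q)
    (h₁ : ¬ (p = (3, false) ∧ q = (4, false))) (h₂ : ¬ (p = (4, false) ∧ q = (3, false))) :
    CombAdj (combShift p) (combShift q) := by
  obtain ⟨i, b⟩ := p
  obtain ⟨j, c⟩ := q
  simp only [CombAdj, _root_.combShift, Prod.mk.injEq] at *
  grind

lemma IsCombVertex.combShift {m : ℕ} (hm : 1 ≤ m) {p : ℕ × Bool} (h : IsCombVertex m p) :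
    IsCombVertex (m + 1) (combShift p) := by
  obtain ⟨i, b⟩ := p
  obtain ⟨h₁, h₂⟩ := h
  refine ⟨?_, fun hb => ?_⟩
  · simp only [_root_.combShift] at *
    split_ifs <;> omega
  · simp only [_root_.combShift] at *
    rcases h₂ hb with h | h | ⟨j, hj, h⟩
    · left; split_ifs <;> omega
    · right; left; split_ifs <;> omega
    · right; right
      split_ifs
      · exact ⟨j, by omega, h⟩
      · exact ⟨j + 1, by omega, by omega⟩

/-- An identification of a tree of the family with a subgraph of the comb, together with an
edge joining two vertices of degree two which is mapped to the spine edge from `3` to `4`. -/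
structure IsCombTree (m n : ℕ) (T : SimpleGraph (Fin n)) (f : Fin n → ℕ × Bool)
    (u v p q : Fin n) : Prop where
  mem : InFamilyT n T
  injective : Function.Injective f
  map_adj : ∀ a b, T.Adj a b → CombAdj (f a) (f b)
  isCombVertex : ∀ a, IsCombVertex m (f a)
  map_left : f u = (3, false)
  map_right : f v = (4, false)
  left_ne : p ≠ v
  right_ne : u ≠ q
  adj_left : ∀ a, T.Adj u a ↔ a = p ∨ a = v
  adj_right : ∀ a, T.Adj v a ↔ a = u ∨ a = q

lemma isCombTree_treeT1 : IsCombTree 1 12 treeT1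
    ![(0, false), (1, false), (2, false), (3, false), (4, false), (5, false), (6, false),
      (7, false), (1, true), (2, true), (5, true), (6, true)] 3 4 2 5 where
  mem := .base1
  injective := by decide
  map_adj := by
    simp only [treeT1, SimpleGraph.fromRel_adj, CombAdj]
    decide
  isCombVertex := by
    intro a
    fin_cases a <;> simp [IsCombVertex]
  map_left := rfl
  map_right := rfl
  left_ne := by decide
  right_ne := by decide
  adj_left := by
    simp only [treeT1, SimpleGraph.fromRel_adj]
    decide
  adj_right := by
    simp only [treeT1, SimpleGraph.fromRel_adj]
    decide

lemma IsCombTree.extend {m n : ℕ} (hm : 1 ≤ m) {T : SimpleGraph (Fin n)} {f : Fin n → ℕ × Bool}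
    {u v p q : Fin n} (h : IsCombTree m n T f u v p q) :
    IsCombTree (m + 1) (n + 4) (extendTree T u v)
      (Fin.addCases (fun a => combShift (f a)) ![(4, false), (5, false), (6, false), (5, true)])
      (Fin.castAdd 4 u) (Fin.natAdd n 0) (Fin.castAdd 4 p) (Fin.natAdd n 1) := by
  have huv : T.Adj u v := (h.adj_left v).2 (Or.inr rfl)
  have hne := @Fin.castAdd_ne_natAdd n 4
  have hshift : ∀ (c : Fin n) (i : Fin 4), combShift (f c) ≠
      (![(4, false), (5, false), (6, false), (5, true)] : Fin 4 → ℕ × Bool) i := by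
    intro c i e
    have := congrArg Prod.fst e
    simp only [combShift] at this
    fin_cases i <;> simp at this <;> split_ifs at this <;> omega
  have hnew : ∀ a (i : Fin 4), (extendTree T u v).Adj (Fin.castAdd 4 a) (Fin.natAdd n i) →
      CombAdj (combShift (f a))
        ((![(4, false), (5, false), (6, false), (5, true)] : Fin 4 → ℕ × Bool) i) := by
    intro a i hai
    rcases (extendTree_adj_castAdd_natAdd _ _ _ _ _).1 hai with ⟨rfl, rfl⟩ | ⟨rfl, rfl⟩
    · rw [h.map_left]; simp [CombAdj, combShift]
    · rw [h.map_right]; simp [CombAdj, combShift]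
  refine ⟨.extend T u v h.mem huv ?_ ?_, ?_, ?_, ?_, ?_, ?_, hne _ _, hne _ _, ?_, ?_⟩
  · have : T.neighborSet u = {p, v} := Set.ext fun a => h.adj_left a
    rw [this, Set.ncard_pair h.left_ne]
  · have : T.neighborSet v = {u, q} := Set.ext fun a => h.adj_right a
    rw [this, Set.ncard_pair h.right_ne]
  · intro a b hab
    induction a using Fin.addCases with
    | left a =>
      induction b using Fin.addCases with
      | left b =>
        simp only [Fin.addCases_left] at hab
        rw [h.injective (combShift_injective hab)]
      | right j =>
        simp only [Fin.addCases_left, Fin.addCases_right] at hab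
        exact absurd hab (hshift a j)
    | right i =>
      induction b using Fin.addCases with
      | left b =>
        simp only [Fin.addCases_left, Fin.addCases_right] at hab
        exact absurd hab.symm (hshift b i)
      | right j =>
        simp only [Fin.addCases_right] at hab
        have : Function.Injective
            (![(4, false), (5, false), (6, false), (5, true)] : Fin 4 → ℕ × Bool) := by decide
        rw [this hab]
  · intro a b hab
    induction a using Fin.addCases with
    | left a =>
      induction b using Fin.addCases with
      | left b =>
        simp only [Fin.addCases_left]
        obtain ⟨h₁, h₂, h₃⟩ := (extendTree_adj_castAdd_castAdd _ _ _ _ _).1 hab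
        refine (h.map_adj a b h₁).combShift ?_ ?_
        · rw [← h.map_left, ← h.map_right, h.injective.eq_iff, h.injective.eq_iff]; exact h₂
        · rw [← h.map_left, ← h.map_right, h.injective.eq_iff, h.injective.eq_iff]; exact h₃
      | right j =>
        simp only [Fin.addCases_left, Fin.addCases_right]
        exact hnew a j hab
    | right i =>
      induction b using Fin.addCases with
      | left b =>
        simp only [Fin.addCases_left, Fin.addCases_right]
        exact (hnew b i hab.symm).symm
      | right j =>
        simp only [Fin.addCases_right]
        have := (extendTree_adj_natAdd_natAdd _ _ _ _ _).1 hab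
        fin_cases i <;> fin_cases j <;> simp [CombAdj] at this ⊢
  · intro a
    induction a using Fin.addCases with
    | left a =>
      simp only [Fin.addCases_left]
      exact (h.isCombVertex a).combShift hm
    | right i =>
      simp only [Fin.addCases_right]
      fin_cases i
      · exact ⟨by simp, by simp⟩
      · exact ⟨by simp; omega, by simp⟩
      · exact ⟨by simp; omega, by simp⟩
      · exact ⟨by simp; omega, fun _ => Or.inr (Or.inr ⟨1, by omega, by simp⟩)⟩
  · simp only [Fin.addCases_left, h.map_left, combShift]; simp
  · simp only [Fin.addCases_right]; rfl
  · intro a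
    induction a using Fin.addCases with
    | left a =>
      simp only [extendTree_adj_castAdd_castAdd, h.adj_left, (Fin.castAdd_injective n 4).eq_iff,
        hne, or_false]
      have := h.left_ne
      have := huv.ne
      grind
    | right i =>
      simp only [extendTree_adj_castAdd_natAdd, (hne _ _).symm, false_or,
        (Fin.natAdd_injective 4 n).eq_iff]
      have := huv.ne
      grind
  · intro a
    induction a using Fin.addCases with
    | left a =>
      simp only [extendTree_adj_natAdd_castAdd, (Fin.castAdd_injective n 4).eq_iff, hne, or_false]
      simp
    | right i =>
      simp only [extendTree_adj_natAdd_natAdd, (hne _ _).symm, false_or,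
        (Fin.natAdd_injective 4 n).eq_iff]
      fin_cases i <;> simp

lemma InFamilyT.exists_comb (m : ℕ) : ∃ (n : ℕ) (T : SimpleGraph (Fin n)) (f : Fin n → ℕ × Bool),
    InFamilyT n T ∧ Function.Injective f ∧ (∀ a b, T.Adj a b → CombAdj (f a) (f b)) ∧
      ∀ a, IsCombVertex m (f a) := by
  rcases m with _ | m
  · refine ⟨8, treeT0, ![(0, false), (1, false), (2, false), (3, false), (4, false), (1, true),
      (2, true), (3, true)], .base0, by decide, ?_, ?_⟩
    · simp only [treeT0, SimpleGraph.fromRel_adj, CombAdj]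
      decide
    · intro a
      fin_cases a <;> simp [IsCombVertex]
  · suffices h : ∃ n T f u v p q, IsCombTree (m + 1) n T f u v p q by
      obtain ⟨n, T, f, u, v, p, q, h⟩ := h
      exact ⟨n, T, f, h.mem, h.injective, h.map_adj, h.isCombVertex⟩
    induction m with
    | zero => exact ⟨_, _, _, _, _, _, _, isCombTree_treeT1⟩
    | succ m ih =>
      obtain ⟨n, T, f, u, v, p, q, h⟩ := ih
      exact ⟨_, _, _, _, _, _, _, h.extend (by omega)⟩

/-- A sequence of vertices starting at `v`, `c` which witnesses `Forces G v c`. -/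
structure IsForcingSequence {V : Type*} (G : SimpleGraph V) (k : ℕ) (y : ℕ → V) (v c : V) :
    Prop where
  zero : y 0 = v
  one : y 1 = c
  adj : ∀ i ≤ 3 * k, G.Adj (y i) (y (i + 1))
  ne : ∀ i, i + 1 ≤ 3 * k → y i ≠ y (i + 2)
  branching : ∀ j < k, IsBranching G (y (3 * (j + 1)))
  last : IsBranching G (y (3 * k + 1))

lemma Forces.exists_isForcingSequence {V : Type*} {G : SimpleGraph V} {v c : V}
    (h : Forces G v c) : ∃ k y, IsForcingSequence G k y v c := by
  induction h with
  | @adj v c h₁ h₂ =>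
    refine ⟨0, fun i => if i = 0 then v else c, by simp, by simp, ?_, by simp, by simp, by simpa⟩
    intro i hi
    obtain rfl : i = 0 := by omega
    simpa
  | @step v c d e f h₁ h₂ h₃ n₁ n₂ hb _ n₃ ih =>
    obtain ⟨k, y, hy⟩ := ih
    refine ⟨k + 1, fun i => match i with
      | 0 => v
      | 1 => c
      | 2 => d
      | i + 3 => y i, rfl, rfl, ?_, ?_, ?_, ?_⟩
    · intro i hi
      match i with
      | 0 => exact h₁
      | 1 => exact h₂
      | 2 => simpa [hy.zero] using h₃
      | i + 3 => exact hy.adj i (by omega)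
    · intro i hi
      match i with
      | 0 => exact n₁.symm
      | 1 => simpa [hy.zero] using n₂.symm
      | 2 => simpa [hy.one] using n₃.symm
      | i + 3 => exact hy.ne i (by omega)
    · intro j hj
      match j with
      | 0 => simpa [hy.zero] using hb
      | j + 1 => exact hy.branching j (by omega)
    · exact hy.last

lemma Forces.exists_adj_isBranching {V : Type*} {G : SimpleGraph V} {v x y : V}
    (hy : Forces G v y) (hb : IsBranching G v) (hx : Forces G v x) (hxy : x ≠ y) :
    ∃ v x y, IsBranching G v ∧ IsBranching G x ∧ G.Adj v x ∧ x ≠ y ∧ Forces G v y := by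
  induction hx generalizing y with
  | @adj v x h₁ h₂ => exact ⟨v, x, y, hb, h₂, h₁, hxy, hy⟩
  | @step v c d e f h₁ h₂ h₃ n₁ n₂ hbe _ n₃ ih =>
    exact ih (.step h₃.symm h₂.symm h₁.symm n₂.symm n₁.symm hb hy hxy.symm) hbe n₃

/-- A non-backtracking walk, with pendant neighbors at its branching vertices, gives rise to a
tree of the family. -/
lemma SimpleGraph.IsAcyclic.exists_inFamilyT {V : Type*} {G : SimpleGraph V} (hG : G.IsAcyclic)
    {m : ℕ} {x ℓ : ℕ → V} (hx : ∀ i ≤ 3 * m + 3, G.Adj (x i) (x (i + 1)))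
    (hne : ∀ i ≤ 3 * m + 2, x i ≠ x (i + 2))
    (hℓ : ∀ i, IsCombVertex m (i, true) → G.Adj (x i) (ℓ i) ∧ ℓ i ≠ x (i - 1) ∧ ℓ i ≠ x (i + 1)) :
    ∃ (n : ℕ) (T : SimpleGraph (Fin n)), InFamilyT n T ∧
      ∃ f : Fin n → V, Function.Injective f ∧ ∀ a b, T.Adj a b → G.Adj (f a) (f b) := by
  obtain ⟨n, T, f, hT, hf, hadj, hcomb⟩ := InFamilyT.exists_comb m
  let g : ℕ × Bool → V := fun p => if p.2 then ℓ p.1 else x p.1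
  have hg : ∀ p q, IsCombVertex m p → IsCombVertex m q → CombAdj p q → G.Adj (g p) (g q) := by
    rintro ⟨i, b⟩ ⟨j, c⟩ hp hq hpq
    have hi := hp.1
    have hj := hq.1
    simp only at hi hj
    simp only [CombAdj] at hpq
    rcases hpq with ⟨rfl, rfl, rfl | rfl⟩ | ⟨rfl, hbc⟩
    · exact hx i (by omega)
    · exact (hx j (by omega)).symm
    · cases b <;> cases c <;> simp at hbc
      · exact (hℓ i hq).1
      · exact (hℓ i hp).1.symm
  let F : T →g G := ⟨g ∘ f, fun {a b} h => hg _ _ (hcomb a) (hcomb b) (hadj a b h)⟩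
  refine ⟨n, T, hT, F, hG.injective_of_locally_injective hT.preconnected F ?_,
    fun a b h => F.map_adj h⟩
  intro a b c hab hac hbc
  have key : ∀ p q r, IsCombVertex m p → IsCombVertex m q → IsCombVertex m r → CombAdj p q →
      CombAdj p r → q ≠ r → g q ≠ g r := by
    rintro ⟨i, b₁⟩ ⟨j, b₂⟩ ⟨k, b₃⟩ h₁ h₂ h₃ h₄ h₅ h₆
    have l₁ := h₁.1
    have l₂ := h₂.1
    have l₃ := h₃.1
    simp only at l₁ l₂ l₃
    simp only [CombAdj] at h₄ h₅
    cases b₁ <;> cases b₂ <;> cases b₃ <;> simp at h₄ h₅ h₆ <;> simp only [g] <;> simp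
    · rcases h₄ with rfl | rfl <;> rcases h₅ with rfl | h₅
      · exact absurd rfl h₆
      · subst h₅
        exact (hne k (by omega)).symm
      · exact hne j (by omega)
      · omega
    · subst h₅
      rcases h₄ with rfl | rfl
      · exact (hℓ _ h₃).2.2.symm
      · exact (hℓ _ h₃).2.1.symm
    · subst h₄
      rcases h₅ with rfl | rfl
      · exact (hℓ _ h₂).2.2
      · exact (hℓ _ h₂).2.1
    · omega
    · omega
  exact key _ _ _ (hcomb a) (hcomb b) (hcomb c) (hadj _ _ hab) (hadj _ _ hac) (hf.ne hbc)

lemma SimpleGraph.IsAcyclic.exists_inFamilyT_of_forces {V : Type*} {G : SimpleGraph V}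
    (hG : G.IsAcyclic) {v x y : V} (hb : IsBranching G v) (hvx : Forces G v x)
    (hvy : Forces G v y) (hxy : x ≠ y) :
    ∃ (n : ℕ) (T : SimpleGraph (Fin n)), InFamilyT n T ∧
      ∃ f : Fin n → V, Function.Injective f ∧ ∀ a b, T.Adj a b → G.Adj (f a) (f b) := by
  obtain ⟨v, c, y, hv, hc, hvc, hcy, hvy⟩ := hvy.exists_adj_isBranching hb hvx hxy
  obtain ⟨k, z, hz⟩ := hvy.exists_isForcingSequence
  obtain ⟨s, hs, hsv, -⟩ := hc v v
  obtain ⟨t, ht, htz, -⟩ := hz.last (z (3 * k)) v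
  let w : ℕ → V := fun i => match i with
    | 0 => s
    | 1 => c
    | i + 2 => if i ≤ 3 * k + 1 then z i else t
  have hw : ∀ i ≤ 3 * k + 1, w (i + 2) = z i := fun i hi => if_pos hi
  have hwt : w (3 * k + 4) = t := if_neg (by omega)
  have hbr : ∀ i, IsCombVertex k (i, true) → IsBranching G (w i) := by
    rintro i ⟨-, hi⟩
    rcases hi rfl with h | h | ⟨j, hj, h⟩ <;> simp only at h <;> subst h
    · exact hc
    · rw [hw _ le_rfl]; exact hz.last
    · rw [hw _ (by omega)]
      rcases j with _ | j
      · simpa [hz.zero] using hv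
      · exact hz.branching j (by omega)
  have hex : ∀ i, ∃ l, IsCombVertex k (i, true) →
      G.Adj (w i) l ∧ l ≠ w (i - 1) ∧ l ≠ w (i + 1) := by
    intro i
    by_cases hi : IsCombVertex k (i, true)
    · obtain ⟨l, hl⟩ := hbr i hi (w (i - 1)) (w (i + 1))
      exact ⟨l, fun _ => hl⟩
    · exact ⟨s, fun h => absurd h hi⟩
  choose ℓ hℓ using hex
  refine hG.exists_inFamilyT (m := k) (x := w) (ℓ := ℓ) ?_ ?_ hℓ
  · intro i hi
    match i with
    | 0 => exact hs.symm
    | 1 => rw [hw 0 (by omega), hz.zero]; exact hvc.symm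
    | i + 2 =>
      rw [hw i (by omega)]
      by_cases h : i = 3 * k + 1
      · subst h
        rw [show 3 * k + 1 + 2 + 1 = 3 * k + 4 by ring, hwt]
        exact ht
      · rw [show i + 2 + 1 = i + 1 + 2 by ring, hw (i + 1) (by omega)]
        exact hz.adj i (by omega)
  · intro i hi
    match i with
    | 0 => rw [hw 0 (by omega), hz.zero]; exact hsv
    | 1 => rw [hw 1 (by omega), hz.one]; exact hcy
    | i + 2 =>
      rw [hw i (by omega)]
      by_cases h : i = 3 * k
      · subst h
        rw [show 3 * k + 2 + 2 = 3 * k + 4 by ring, hwt]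
        exact htz.symm
      · rw [hw (i + 2) (by omega)]
        exact hz.ne i (by omega)

/-- A tree admits a `(1,2,2)`-packing coloring if and only if it contains no subgraph
isomorphic to a tree from the family `𝒯`. -/
theorem tree_122_colorable_iff {V : Type*} [Fintype V] (G : SimpleGraph V)
    (hG : G.IsTree) :
    (∃ c : V → Fin 3, IsPackingColoring G ![1, 2, 2] c) ↔
      ¬ ∃ (n : ℕ) (T : SimpleGraph (Fin n)), InFamilyT n T ∧
        ∃ f : Fin n → V, Function.Injective f ∧ ∀ a b, T.Adj a b → G.Adj (f a) (f b) := by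
  constructor
  · rintro ⟨c, hc⟩ ⟨n, T, hT, f, hf, hadj⟩
    exact hT.not_isPackingCore _ (hc.isPackingCore.comap hf hadj)
  · intro h
    obtain ⟨J, r, hJ, hr⟩ := hG.exists_isPackingCore fun v x y hv hx hy => by
      by_contra hxy
      exact h (hG.isAcyclic.exists_inFamilyT_of_forces hv hx hy hxy)
    exact hJ.exists_isPackingColoring hG hr
end

section
/- Let r ≥ 3 be an integer. No finite r-regular simple graph with at least one vertex admits a (1,2,2)-packing coloring. -/
section
variable {V : Type*} {G : SimpleGraph V} {c : V → Fin 3}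

/-- Every color of a `(1,2,2)`-packing coloring is used on an independent set. -/
theorem IsPackingColoring.ne_of_adj_s6 (hc : IsPackingColoring G ![1, 2, 2] c) {u v : V}
    (h : G.Adj u v) : c u ≠ c v := by
  intro huv
  have hlt := hc u v h.ne huv h.reachable
  rw [SimpleGraph.dist_eq_one_iff_adj.mpr h] at hlt
  generalize c u = i at hlt
  fin_cases i <;> simp at hlt

/-- Two vertices with a common neighbor and the same color of a `(1,2,2)`-packing coloring
coincide, unless that color is `0`. -/
theorem IsPackingColoring.eq_of_common_neighbor (hc : IsPackingColoring G ![1, 2, 2] c)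
    {u v w : V} (hu : G.Adj v u) (hw : G.Adj v w) (huw : c u = c w) (h0 : c u ≠ 0) : u = w := by
  by_contra hne
  let p : G.Walk u w := .cons hu.symm (.cons hw .nil)
  have hlt := hc u w hne huw p.reachable
  have hle : G.dist u w ≤ 2 := SimpleGraph.dist_le p
  generalize c u = i at hlt h0
  fin_cases i <;> simp at hlt h0 <;> omega

/-- In a `(1,2,2)`-packing coloring, every vertex of degree at least `3` has a neighbor
of color `0`. -/
theorem IsPackingColoring.exists_adj_eq_zero (hc : IsPackingColoring G ![1, 2, 2] c) (v : V)
    [Fintype (G.neighborSet v)] (hv : 3 ≤ G.degree v) : ∃ u, G.Adj v u ∧ c u = 0 := by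
  by_contra! h
  have hcard : ({1, 2} : Finset (Fin 3)).card < (G.neighborFinset v).card := by
    rw [G.card_neighborFinset_eq_degree]
    exact hv
  obtain ⟨u, hu, w, hw, hne, huw⟩ :=
    Finset.exists_ne_map_eq_of_card_lt_of_maps_to hcard (f := c) (by
      intro u hu
      have hu0 := h u (by simpa using hu)
      generalize c u = i at hu0
      revert hu0
      revert i
      decide)
  rw [SimpleGraph.mem_neighborFinset] at hu hw
  exact hne (hc.eq_of_common_neighbor hu hw huw (h u hu))

end

/-- For `r ≥ 3`, no finite `r`-regular simple graph with at least one vertex admits a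
`(1,2,2)`-packing coloring. -/
theorem regular_not_122_colorable {V : Type*} [Fintype V] [Nonempty V]
    (G : SimpleGraph V) [DecidableRel G.Adj] (r : ℕ) (hr : 3 ≤ r)
    (hreg : G.IsRegularOfDegree r) :
    ¬ ∃ c : V → Fin 3, IsPackingColoring G ![1, 2, 2] c := by
  rintro ⟨c, hc⟩
  have hdeg (v : V) : 3 ≤ G.degree v := hr.trans_eq (hreg v).symm
  obtain ⟨v⟩ := ‹Nonempty V›
  obtain ⟨a, -, ha⟩ := hc.exists_adj_eq_zero v (hdeg v)
  obtain ⟨b, hab, hb⟩ := hc.exists_adj_eq_zero a (hdeg a)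
  exact hc.ne_of_adj_s6 hab (ha.trans hb.symm)
end

section
/- The spider tree Y_4, consisting of a center vertex with three pendant paths of length 4 attached to it, admits no (2,2,3,4)-packing coloring. -/
/-- The spider tree `Y₄`: a center (vertex `0`) with three pendant paths of length `4`
(legs `1-2-3-4`, `5-6-7-8`, `9-10-11-12`). -/
def spiderY4 : SimpleGraph (Fin 13) :=
  SimpleGraph.fromRel (fun u v =>
    (u, v) ∈ ([(0,1),(1,2),(2,3),(3,4),
               (0,5),(5,6),(6,7),(7,8),
               (0,9),(9,10),(10,11),(11,12)] : List (Fin 13 × Fin 13)))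

/-- The neighbor of `u` on the way to the center of `Y₄` (the center is its own parent). -/
def spiderParent (u : Fin 13) : Fin 13 :=
  if u = 5 ∨ u = 9 then 0 else ⟨u.val - 1, by omega⟩

/-- Whether `u` and `v` meet after at most `n` moves to a parent, where each move is made
by the vertex with the larger label. -/
def spiderNear : ℕ → Fin 13 → Fin 13 → Bool
  | 0, u, v => decide (u = v)
  | n + 1, u, v => decide (u = v) ||
      if v < u then spiderNear n (spiderParent u) v else spiderNear n u (spiderParent v)

/-- Whether the partial coloring `a` extends, one vertex at a time, to the vertices in the list
so that no two vertices `u ≠ v` of the same color `x` satisfy `spiderNear (s x) u v`. -/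
def spiderExtends (s : Fin 4 → ℕ) : List (Fin 13) → List (Fin 13 × Fin 4) → Bool
  | [], _ => true
  | v :: vs, a => (List.finRange 4).any fun x =>
      (a.all fun p => !(decide (p.2 = x) && decide (p.1 ≠ v) && spiderNear (s x) p.1 v)) &&
        spiderExtends s vs ((v, x) :: a)

theorem spiderY4_adj_parent {u : Fin 13} (hu : u ≠ 0) : spiderY4.Adj u (spiderParent u) := by
  revert u
  simp only [spiderY4, SimpleGraph.fromRel_adj]
  decide

theorem exists_walk_of_spiderNear {n : ℕ} {u v : Fin 13} (h : spiderNear n u v = true) :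
    ∃ p : spiderY4.Walk u v, p.length ≤ n := by
  induction n generalizing u v with
  | zero =>
    obtain rfl : u = v := by simpa [spiderNear] using h
    exact ⟨.nil, le_rfl⟩
  | succ n ih =>
    by_cases huv : u = v
    · subst huv
      exact ⟨.nil, Nat.zero_le _⟩
    by_cases hlt : v < u
    · obtain ⟨p, hp⟩ := ih (u := spiderParent u) (v := v) (by simpa [spiderNear, huv, hlt] using h)
      exact ⟨.cons (spiderY4_adj_parent (by omega)) p, by simpa using hp⟩
    · obtain ⟨p, hp⟩ := ih (u := u) (v := spiderParent v) (by simpa [spiderNear, huv, hlt] using h)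
      exact ⟨p.concat (spiderY4_adj_parent (by omega)).symm, by simpa using hp⟩

theorem IsPackingColoring.spiderExtends {s : Fin 4 → ℕ} {c : Fin 13 → Fin 4}
    (hc : IsPackingColoring spiderY4 s c) (vs : List (Fin 13)) (a : List (Fin 13 × Fin 4))
    (ha : ∀ p ∈ a, p.2 = c p.1) : spiderExtends s vs a = true := by
  induction vs generalizing a with
  | nil => rfl
  | cons v vs ih =>
    refine List.any_eq_true.2 ⟨c v, List.mem_finRange _, ?_⟩
    rw [Bool.and_eq_true, List.all_eq_true]
    refine ⟨fun p hp => ?_, ih _ (List.forall_mem_cons.2 ⟨rfl, ha⟩)⟩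
    by_contra h
    simp only [Bool.not_eq_true', Bool.not_eq_false, Bool.and_eq_true, decide_eq_true_eq] at h
    obtain ⟨⟨hx, hne⟩, hnear⟩ := h
    have hcol : c p.1 = c v := (ha p hp).symm.trans hx
    obtain ⟨w, hw⟩ := exists_walk_of_spiderNear hnear
    have hdist := hc _ _ hne hcol w.reachable
    rw [hcol] at hdist
    exact absurd (hdist.trans_le (SimpleGraph.dist_le w)) hw.not_gt

/-- `Y₄` admits no `(2,2,3,4)`-packing coloring. -/
theorem spiderY4_not_2234_colorable :
    ¬ ∃ c : Fin 13 → Fin 4, IsPackingColoring spiderY4 ![2, 2, 3, 4] c := by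
  rintro ⟨c, hc⟩
  have hext := hc.spiderExtends [0, 1, 5, 9, 2, 3, 4, 6, 7, 8, 10, 11, 12] [] (by simp)
  revert hext
  decide +kernel
end

section
/- The path P_6 on 6 vertices admits no (2,2,3)-packing coloring. -/
/-- On a path, the distance is at most the difference of the positions. -/
theorem SimpleGraph.pathGraph_dist_le {n : ℕ} (u v : Fin n) (h : u ≤ v) :
    (SimpleGraph.pathGraph n).dist u v ≤ (v : ℕ) - u := by
  obtain ⟨v, hv⟩ := v
  induction v with
  | zero =>
    have : u = ⟨0, hv⟩ := le_antisymm h (Nat.zero_le _)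
    simp [this]
  | succ m ih =>
    rcases h.eq_or_lt with rfl | hlt
    · simp
    · have hum : (u : ℕ) ≤ m := Nat.lt_succ_iff.mp hlt
      have hm : m < n := by omega
      have hadj : (SimpleGraph.pathGraph n).Adj ⟨m, hm⟩ ⟨m + 1, hv⟩ :=
        SimpleGraph.pathGraph_adj.mpr (Or.inl rfl)
      obtain ⟨p, hp⟩ :=
        (SimpleGraph.pathGraph_preconnected n u ⟨m, hm⟩).exists_walk_length_eq_dist
      have hle := SimpleGraph.dist_le (p.concat hadj)
      have := ih hm hum
      rw [SimpleGraph.Walk.length_concat, hp] at hle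
      dsimp only at this ⊢
      omega

/-- In a packing coloring of a path, two vertices of the same color `i` differ in position by
more than `s i`. -/
theorem IsPackingColoring.lt_sub_of_pathGraph {n k : ℕ} {s : Fin k → ℕ} {c : Fin n → Fin k}
    (hc : IsPackingColoring (SimpleGraph.pathGraph n) s c) {u v : Fin n} (huv : u < v)
    (h : c u = c v) : s (c u) < (v : ℕ) - u :=
  (hc u v huv.ne h (SimpleGraph.pathGraph_preconnected n u v)).trans_le
    (SimpleGraph.pathGraph_dist_le u v huv.le)

/-- The path `P₆` on `6` vertices admits no `(2,2,3)`-packing coloring. -/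
theorem pathGraph6_not_223_colorable :
    ¬ ∃ c : Fin 6 → Fin 3, IsPackingColoring (SimpleGraph.pathGraph 6) ![2, 2, 3] c := by
  rintro ⟨c, hc⟩
  have two_le : ∀ i : Fin 3, 2 ≤ (![2, 2, 3] : Fin 3 → ℕ) i := by decide
  have near : ∀ u v : Fin 6, u < v → (v : ℕ) - u ≤ 2 → c u ≠ c v := fun u v huv hd h =>
    absurd (hc.lt_sub_of_pathGraph huv h) (by have := two_le (c u); omega)
  have far : ∀ u v : Fin 6, u < v → (v : ℕ) - u = 3 → c u = c v → c u ≠ 2 := by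
    intro u v huv hd h h2
    have := hc.lt_sub_of_pathGraph huv h
    rw [h2, hd] at this
    exact absurd this (by decide)
  -- Any three consecutive vertices use all three colors, so the coloring has period 3.
  have period : ∀ a b d e : Fin 3, a ≠ b → a ≠ d → b ≠ d → b ≠ e → d ≠ e → a = e := by decide
  have all : ∀ a b d : Fin 3, a ≠ b → a ≠ d → b ≠ d → a = 2 ∨ b = 2 ∨ d = 2 := by decide
  have n01 := near 0 1 (by decide) (by decide)
  have n02 := near 0 2 (by decide) (by decide)
  have n12 := near 1 2 (by decide) (by decide)
  have n13 := near 1 3 (by decide) (by decide)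
  have n23 := near 2 3 (by decide) (by decide)
  have n24 := near 2 4 (by decide) (by decide)
  have n34 := near 3 4 (by decide) (by decide)
  have n35 := near 3 5 (by decide) (by decide)
  have n45 := near 4 5 (by decide) (by decide)
  rcases all _ _ _ n01 n02 n12 with h | h | h
  · exact far 0 3 (by decide) (by decide) (period _ _ _ _ n01 n02 n12 n13 n23) h
  · exact far 1 4 (by decide) (by decide) (period _ _ _ _ n12 n13 n23 n24 n34) h
  · exact far 2 5 (by decide) (by decide) (period _ _ _ _ n23 n24 n34 n35 n45) h
end

section
/- In every (2,2,3,3)-packing coloring of the spider tree Y_2 (a center vertex with three pendant paths of length 2 attached to it), the center vertex receives a color from {3, 4}, i.e., the center always belongs to one of the two 3-packing classes. -/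
/-- The spider tree `Y₂`: a center (vertex `0`) with three pendant paths of length `2`
(legs `1-2`, `3-4`, `5-6`). -/
def spiderY2 : SimpleGraph (Fin 7) :=
  SimpleGraph.fromRel (fun u v =>
    (u, v) ∈ ([(0,1),(1,2),(0,3),(3,4),(0,5),(5,6)] : List (Fin 7 × Fin 7)))

theorem IsPackingColoring.lt_length {V : Type*} {G : SimpleGraph V} {k : ℕ} {s : Fin k → ℕ}
    {c : V → Fin k} (h : IsPackingColoring G s c) {u v : V} (huv : u ≠ v) (hc : c u = c v)
    (p : G.Walk u v) : s (c u) < p.length :=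
  (h u v huv hc p.reachable).trans_le (SimpleGraph.dist_le p)

/-- In every `(2,2,3,3)`-packing coloring of `Y₂` (colors `0, 1` are the `2`-packing
classes and colors `2, 3` are the `3`-packing classes), the center receives a color
from the two `3`-packing classes. -/
theorem spiderY2_center_color_2233 (c : Fin 7 → Fin 4)
    (h : IsPackingColoring spiderY2 ![2, 2, 3, 3] c) :
    c 0 = 2 ∨ c 0 = 3 := by
  have two_le : ∀ i : Fin 4, 2 ≤ (![2, 2, 3, 3] : Fin 4 → ℕ) i := by decide
  have eq_of_lt_three : ∀ i : Fin 4, (![2, 2, 3, 3] : Fin 4 → ℕ) i < 3 → i = 0 ∨ i = 1 := by decide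
  have h01 : spiderY2.Adj 0 1 := by simp [spiderY2]
  have h12 : spiderY2.Adj 1 2 := by simp [spiderY2]
  have h03 : spiderY2.Adj 0 3 := by simp [spiderY2]
  have h34 : spiderY2.Adj 3 4 := by simp [spiderY2]
  have h05 : spiderY2.Adj 0 5 := by simp [spiderY2]
  have h56 : spiderY2.Adj 5 6 := by simp [spiderY2]
  have ne_of_adj {u v : Fin 7} (huv : spiderY2.Adj u v) : c u ≠ c v := fun hc => by
    have hlt := h.lt_length huv.ne hc huv.toWalk
    exact absurd hlt (not_lt.mpr (one_le_two.trans (two_le (c u))))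
  have ne_of_adj_adj {u v w : Fin 7} (huw : u ≠ w) (huv : spiderY2.Adj u v)
      (hvw : spiderY2.Adj v w) : c u ≠ c w := fun hc => by
    have hlt := h.lt_length huw hc (.cons huv hvw.toWalk)
    exact absurd hlt (not_lt.mpr (two_le (c u)))
  have eq_or_eq_of_path {u v w x : Fin 7} (hux : u ≠ x) (huv : spiderY2.Adj u v)
      (hvw : spiderY2.Adj v w) (hwx : spiderY2.Adj w x) (hc : c u = c x) :
      c u = 0 ∨ c u = 1 :=
    eq_of_lt_three _ (h.lt_length hux hc (.cons huv (.cons hvw hwx.toWalk)))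
  have a01 := ne_of_adj h01
  have a12 := ne_of_adj h12
  have a03 := ne_of_adj h03
  have a34 := ne_of_adj h34
  have a05 := ne_of_adj h05
  have a56 := ne_of_adj h56
  have b02 := ne_of_adj_adj (by decide) h01 h12
  have b04 := ne_of_adj_adj (by decide) h03 h34
  have b06 := ne_of_adj_adj (by decide) h05 h56
  have b13 := ne_of_adj_adj (by decide) h01.symm h03
  have b15 := ne_of_adj_adj (by decide) h01.symm h05
  have b35 := ne_of_adj_adj (by decide) h03.symm h05
  have d23 := eq_or_eq_of_path (by decide) h12.symm h01.symm h03
  have d25 := eq_or_eq_of_path (by decide) h12.symm h01.symm h05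
  have d41 := eq_or_eq_of_path (by decide) h34.symm h03.symm h01
  have d45 := eq_or_eq_of_path (by decide) h34.symm h03.symm h05
  have d61 := eq_or_eq_of_path (by decide) h56.symm h05.symm h01
  have d63 := eq_or_eq_of_path (by decide) h56.symm h05.symm h03
  by_contra hcon
  have n1 : c 1 = 2 ∨ c 1 = 3 := by clear d41 d61 d63 d45 a34 a56 b04 b06; omega
  have n3 : c 3 = 2 ∨ c 3 = 3 := by clear d23 d25 d61 d63 a12 a56 b02 b06; omega
  have n5 : c 5 = 2 ∨ c 5 = 3 := by clear d23 d25 d41 d45 a12 a34 b02 b04; omega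
  omega
end
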